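/- arXiv:0706.2118 — 3 statements merged into one kernel-verified Lean document; each statement's English description precedes it below -/
import Mathlib

section
/- Let F : 𝒫 → Ab be an n-condensed functor on a graded poset 𝒫, with short exact sequence 0 → F → Ker'_F → G → 0. Then G is (n+1)-condensed if and only if for each object p₀ of degree greater than n+1 the natural map F(p₀) → lim_{(p₀↓𝒫)_*} F is an isomorphism. -/
open Finset

/-- A graded poset (with the standing assumptions of Remark 2.5: the degree function is
order-reversing, adds one along preceding pairs, takes nonnegative values, and every
up-set is finite). -/
structure GradedPoset (P : Type) [PartialOrder P] : Type where
  deg : P → ℤ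
  deg_antitone : ∀ ⦃p q : P⦄, p ≤ q → deg q ≤ deg p
  deg_step : ∀ ⦃p q : P⦄, p < q → (∀ r, p ≤ r → r ≤ q → r = p ∨ r = q) → deg p = deg q + 1
  deg_nonneg : ∀ p, 0 ≤ deg p
  finite_up : ∀ p : P, {q : P | p ≤ q}.Finite

/-- A functor from a poset `P` to the category `Ab` of abelian groups. -/
structure PosetFunctor (P : Type) [PartialOrder P] : Type 1 where
  obj : P → Type
  grp : ∀ p, AddCommGroup (obj p)
  map : ∀ {p q : P}, p ≤ q → obj p →+ obj q
  map_id : ∀ (p : P) (x : obj p), map (le_refl p) x = x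
  map_comp : ∀ {p q r : P} (h₁ : p ≤ q) (h₂ : q ≤ r) (x : obj p),
    map h₂ (map h₁ x) = map (h₁.trans h₂) x

attribute [instance] PosetFunctor.grp

variable {P : Type} [PartialOrder P]

/-- A natural transformation between functors `P → Ab`. -/
structure PosetHom (F G : PosetFunctor P) : Type where
  app : ∀ p : P, F.obj p →+ G.obj p
  naturality : ∀ {p q : P} (h : p ≤ q) (x : F.obj p),
    G.map h (app p x) = app q (F.map h x)

/-- The constant functor with value `ℤ`. -/
def constZ (P : Type) [PartialOrder P] : PosetFunctor P where
  obj _ := ℤ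
  grp _ := inferInstance
  map _ := AddMonoidHom.id ℤ
  map_id _ _ := rfl
  map_comp _ _ _ := rfl

namespace PosetFunctor

/-- The inverse limit `lim F` of `F : P → Ab`, realized as the group of compatible
families (sections). -/
def sections (F : PosetFunctor P) : AddSubgroup (∀ p, F.obj p) where
  carrier := {x | ∀ (p q : P) (h : p ≤ q), F.map h (x p) = x q}
  zero_mem' := by intro p q h; simp
  add_mem' := by intro a b ha hb p q h; simp [map_add, ha p q h, hb p q h]
  neg_mem' := by intro a ha p q h; simp [ha p q h]

/-- The functor `F'` with `F'(p₀) = ∏_{p₀ ≤ p} F(p)`; a morphism `p₁ ≤ p₀` acts by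
sending the factor indexed by `p₁ ≤ p` identically to the factor indexed by `p₀ ≤ p`
when `p₀ ≤ p`, and by zero otherwise. -/
def prime (F : PosetFunctor P) : PosetFunctor P where
  obj p₀ := ∀ q : {q : P // p₀ ≤ q}, F.obj q.1
  grp _ := inferInstance
  map h := AddMonoidHom.mk' (fun x q => x ⟨q.1, h.trans q.2⟩) (fun _ _ => rfl)
  map_id _ _ := rfl
  map_comp _ _ _ := rfl

end PosetFunctor

/-- The subgroup `Ker_F(p₀) = ⋂_{p₀ < q} Ker (F(p₀ → q))`. -/
def kerAt (F : PosetFunctor P) (p₀ : P) : AddSubgroup (F.obj p₀) where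
  carrier := {x | ∀ (q : P) (h : p₀ < q), F.map h.le x = 0}
  zero_mem' := by intro q h; simp
  add_mem' := by intro a b ha hb q h; simp [map_add, ha q h, hb q h]
  neg_mem' := by intro a ha q h; simp [ha q h]

/-- `F` is `n`-condensed: `F(p) = 0` for `deg p < n` and `Ker_F(p) = 0` for `deg p > n`. -/
def IsCondensed (G : GradedPoset P) (F : PosetFunctor P) (n : ℕ) : Prop :=
  (∀ p : P, G.deg p < (n : ℤ) → ∀ x : F.obj p, x = 0) ∧
  (∀ p : P, (n : ℤ) < G.deg p → ∀ x ∈ kerAt F p, x = 0)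

/-- The set `(p₀ ↓ P)_n` of objects above `p₀` of degree `n`. -/
def degSet (G : GradedPoset P) (p₀ : P) (n : ℕ) : Set P :=
  {q : P | p₀ ≤ q ∧ G.deg q = (n : ℤ)}

/-- The functor `Ker'_F` (for an `n`-condensed functor `F`):
`Ker'_F(p₀) = ∏_{p ∈ (p₀↓P)_n} F(p)`. -/
def kerPrime (G : GradedPoset P) (F : PosetFunctor P) (n : ℕ) : PosetFunctor P where
  obj p₀ := ∀ q : degSet G p₀ n, F.obj q.1
  grp _ := inferInstance
  map h := AddMonoidHom.mk' (fun x q => x ⟨q.1, h.trans q.2.1, q.2.2⟩) (fun _ _ => rfl)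
  map_id _ _ := rfl
  map_comp _ _ _ := rfl

/-- The natural transformation `λ : F ⇒ Ker'_F` with components
`λ_{p₀} = ∏_{p ∈ (p₀↓P)_n} F(p₀ → p)`. -/
def lambdaNT (G : GradedPoset P) (F : PosetFunctor P) (n : ℕ) :
    PosetHom F (kerPrime G F n) where
  app p₀ := AddMonoidHom.mk' (fun x q => F.map q.2.1 x)
    (by intro a b; funext q; exact map_add _ a b)
  naturality := by
    intro p q h x
    funext r
    exact (F.map_comp h r.2.1 x).symm

/-! ### The cochain complex computing higher inverse limits -/

/-- Composable chains `p₀ ≤ p₁ ≤ … ≤ pₙ` in `P`. -/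
def ChainP (P : Type) [PartialOrder P] (n : ℕ) : Type :=
  {c : Fin (n + 1) → P // Monotone c}

/-- `n`-cochains of the cobar complex computing the derived functors of `lim` over `P`
with coefficients in `F`. -/
abbrev cochain (F : PosetFunctor P) (n : ℕ) : Type :=
  ∀ c : ChainP P n, F.obj (c.1 (Fin.last n))

/-- The `i`-th face of a chain. -/
def chainFace {n : ℕ} (i : Fin (n + 2)) (c : ChainP P (n + 1)) : ChainP P n :=
  ⟨c.1 ∘ i.succAbove, c.2.comp (Fin.strictMono_succAbove i).monotone⟩

/-- The differential of the cobar complex. -/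
noncomputable def cobarDiff (F : PosetFunctor P) (n : ℕ) : cochain F n →+ cochain F (n + 1) :=
  AddMonoidHom.mk'
    (fun ψ c => ∑ i : Fin (n + 2),
      ((-1 : ℤ) ^ (i : ℕ)) • F.map (c.2 (Fin.le_last (i.succAbove (Fin.last n))))
        (ψ (chainFace i c)))
    (by
      intro a b; funext c
      simp only [Pi.add_apply, map_add, smul_add]
      refine Eq.trans (Finset.sum_congr rfl fun i _ => ?_) Finset.sum_add_distrib
      exact (congrArg (fun y => ((-1 : ℤ) ^ (i : ℕ)) • y)
        ((F.map (c.2 (Fin.le_last (i.succAbove (Fin.last n))))).map_add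
          (a (chainFace i c)) (b (chainFace i c)))).trans (smul_add _ _ _))

/-- Coboundaries of the cobar complex. -/
noncomputable def cobarCoboundaries (F : PosetFunctor P) : ∀ n : ℕ, AddSubgroup (cochain F n)
  | 0 => ⊥
  | n + 1 => (cobarDiff F n).range

/-- `H^n(P; F) = lim^n F`, the cohomology of `P` with coefficients in `F`, computed by
the cobar complex. -/
noncomputable def cohomologyOf (F : PosetFunctor P) (n : ℕ) : Type :=
  (cobarDiff F n).ker ⧸ ((cobarCoboundaries F n).addSubgroupOf (cobarDiff F n).ker)

noncomputable instance (F : PosetFunctor P) (n : ℕ) : AddCommGroup (cohomologyOf F n) :=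
  inferInstanceAs (AddCommGroup (_ ⧸ _))

/-- The `n`-th Betti number of `P` with coefficients in `F`: the rank of `H^n(P;F)`. -/
noncomputable def bettiOf (F : PosetFunctor P) (n : ℕ) : ℕ :=
  Module.finrank ℤ (cohomologyOf F n)

/-! ### Free functors, pure maps, local covering families -/

/-- A functor is free if all its values are finitely generated free abelian groups. -/
def IsFreeFunctor (F : PosetFunctor P) : Prop :=
  ∀ p : P, Module.Free ℤ (F.obj p) ∧ Module.Finite ℤ (F.obj p)

/-- A map of abelian groups is pure if its cokernel is a free abelian group. -/
def IsPureHom {A B : Type} [AddCommGroup A] [AddCommGroup B] (f : A →+ B) : Prop :=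
  Module.Free ℤ (B ⧸ f.range)

/-- Sections of `F` over a subset `S ⊆ P`, i.e. `lim_S F`. -/
def sectionsOnSet (F : PosetFunctor P) (S : Set P) : Set (∀ q : S, F.obj q.1) :=
  {x | ∀ (q r : S) (h : q.1 ≤ r.1), F.map h (x q) = x r}

/-- The restriction map `lim_{(p₀↓P)_*} F → ∏_{q ∈ S} F(q)` (for `S` a set of objects
strictly above `p₀`, realized by intersecting with `{q | p₀ < q}`). -/
def limRestriction (F : PosetFunctor P) (p₀ : P) (S : Set P) :
    ↥(sectionsOnSet F {q : P | p₀ < q}) → ∀ q : ↥(S ∩ {q : P | p₀ < q}), F.obj q.1 :=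
  fun x q => x.1 ⟨q.1, q.2.2⟩

/-- The map `F(p₀) → ∏_{q ∈ S} F(q)` (for `S` a set of objects above `p₀`, realized by
intersecting with `{q | p₀ ≤ q}`). -/
def detMap (F : PosetFunctor P) (p₀ : P) (S : Set P) :
    F.obj p₀ →+ ∀ q : ↥(S ∩ {q : P | p₀ ≤ q}), F.obj q.1 :=
  AddMonoidHom.mk' (fun x q => F.map q.2.2 x) (by intro a b; funext q; exact map_add _ a b)

/-- A local covering family `𝒥 = {J_n^{p₀}}` (Definition 3.4). -/
def IsLCF (G : GradedPoset P) (J : P → ℕ → Set P) : Prop :=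
  (∀ (p : P) (m : ℕ), J p m ⊆ degSet G p m) ∧
  (∀ (p : P) (m : ℕ), (m : ℤ) < G.deg p →
    (⋃ r ∈ J p (m + 1), degSet G r m) = degSet G p m) ∧
  (∀ (p : P) (m : ℕ), ∀ r ∈ J p (m + 1), J r m ⊆ J p m)

/-- `F` (an `n`-condensed free functor) is `𝒥`-determined (Definition 3.5). -/
def IsDetermined (G : GradedPoset P) (J : P → ℕ → Set P) (F : PosetFunctor P) (n : ℕ) :
    Prop :=
  (∀ p₀ : P, (n : ℤ) + 1 < G.deg p₀ →
    Function.Injective (limRestriction F p₀ (J p₀ n)) ∧ IsPureHom (detMap F p₀ (J p₀ n))) ∧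
  (∀ p₀ : P, G.deg p₀ = (n : ℤ) + 1 →
    IsPureHom (detMap F p₀ (J p₀ n)) ∧ Function.Injective (detMap F p₀ (J p₀ n)))

/-- The finite set `(p↓P)_n`. -/
noncomputable def degFinset (G : GradedPoset P) (p : P) (n : ℕ) : Finset P :=
  ((G.finite_up p).subset
    (show degSet G p n ⊆ {q : P | p ≤ q} from fun _ hq => hq.1)).toFinset

/-- The numbers `R_n^{p₀}` (Definition 4.1). -/
noncomputable def Rnum (G : GradedPoset P) : ℕ → P → ℤ
  | 0, _ => 1
  | m + 1, p => (∑ q ∈ degFinset G p m, Rnum G m q) - Rnum G m p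

/-- The finite set `J_n^p` (as a `Finset`, using finiteness of up-sets). -/
noncomputable def JFinset (G : GradedPoset P) (J : P → ℕ → Set P) (p : P) (n : ℕ) :
    Finset P :=
  ((G.finite_up p).inter_of_left (J p n)).toFinset

/-- Connectedness of a subset of a poset, viewed as a full subcategory. -/
def IsConnectedSet (S : Set P) : Prop :=
  S.Nonempty ∧ ∀ a b : S, Relation.ReflTransGen (fun x y : S => x.1 ≤ y.1 ∨ y.1 ≤ x.1) a b

/-- An adequate local covering family (Definition 4.2). -/
def IsAdequate (G : GradedPoset P) (J : P → ℕ → Set P) : Prop :=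
  IsLCF G J ∧
  (∀ p : P, 2 ≤ G.deg p → IsConnectedSet {q : P | p < q}) ∧
  (∀ (m : ℕ) (p : P), (m : ℤ) + 1 ≤ G.deg p →
    Rnum G m p = ∑ q ∈ JFinset G J p m, Rnum G m q)

/-! ### The global complex and global covering families -/

/-- Restriction of a product of abelian groups to a subset of the index set. -/
def restrictTo {ι : Type} {A : ι → Type} [∀ i, AddCommGroup (A i)] (S : Set ι) :
    (∀ i, A i) →+ ∀ i : S, A i.1 :=
  AddMonoidHom.mk' (fun x i => x i.1) (fun _ _ => rfl)

open Classical in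
/-- Extension by zero of a family indexed by a subset of the index set. -/
noncomputable def extendZero {ι : Type} {A : ι → Type} [∀ i, AddCommGroup (A i)]
    (S : Set ι) : (∀ i : S, A i.1) →+ ∀ i, A i :=
  AddMonoidHom.mk' (fun x i => if h : i ∈ S then x ⟨i, h⟩ else 0)
    (by intro a b; funext i; by_cases h : i ∈ S <;> simp [h])

/-- The map on full products induced by a natural transformation
`π : Ker'_F ⇒ F'` (the building block of the differential `d = ι ∘ ω`). -/
noncomputable def dhat (G : GradedPoset P) {F F' : PosetFunctor P} (n : ℕ)
    (π : PosetHom (kerPrime G F n) F') : (∀ p : P, F.obj p) →+ ∀ p : P, F'.obj p :=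
  AddMonoidHom.mk' (fun x p => π.app p (fun q => x q.1))
    (by intro a b; funext p; exact map_add (π.app p) _ _)

/-- The set `Ob_n(P)` of objects of degree `n`. -/
def obSet (G : GradedPoset P) (n : ℕ) : Set P := {p : P | G.deg p = (n : ℤ)}

/-- The differential `d_n = ι_{n+1} ∘ ω_{n+1} : ∏_{Ob_n} F_n(p) → ∏_{Ob_{n+1}} F_{n+1}(p)`. -/
noncomputable def obDiff (G : GradedPoset P) (F : ℕ → PosetFunctor P)
    (π : ∀ n : ℕ, PosetHom (kerPrime G (F n) n) (F (n + 1))) (n : ℕ) :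
    (∀ p : ↥(obSet G n), (F n).obj p.1) →+ ∀ p : ↥(obSet G (n + 1)), (F (n + 1)).obj p.1 :=
  (restrictTo (obSet G (n + 1))).comp ((dhat G n (π n)).comp (extendZero (obSet G n)))

/-- The composite `∏_{p ∈ Ob_n(P)∖K_n} F_n(p) → ∏_{p ∈ K_{n+1}} F_{n+1}(p)`
induced by the differential. -/
noncomputable def wMap (G : GradedPoset P) (F : ℕ → PosetFunctor P)
    (π : ∀ n : ℕ, PosetHom (kerPrime G (F n) n) (F (n + 1))) (K : ℕ → Set P) (n : ℕ) :
    (∀ p : ↥(obSet G n \ K n), (F n).obj p.1) →+ ∀ p : ↥(K (n + 1)), (F (n + 1)).obj p.1 :=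
  (restrictTo (K (n + 1))).comp ((dhat G n (π n)).comp (extendZero (obSet G n \ K n)))

/-- A global covering family (Definition 5.1). -/
def IsGCF (G : GradedPoset P) (F : ℕ → PosetFunctor P)
    (π : ∀ n : ℕ, PosetHom (kerPrime G (F n) n) (F (n + 1))) (K : ℕ → Set P) : Prop :=
  (∀ n : ℕ, K n ⊆ obSet G n) ∧
  (∀ n : ℕ, Function.Injective
    (fun (s : ↥(PosetFunctor.sections (F n))) => (fun p : ↥(K n) => s.1 p.1))) ∧
  (∀ n : ℕ, IsPureHom (wMap G F π K n))

/-- `Ob_n(P)` as a `Finset` (given that each degree level is finite). -/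
noncomputable def obFinset (G : GradedPoset P)
    (hfin : ∀ i : ℤ, {p : P | G.deg p = i}.Finite) (n : ℕ) : Finset P :=
  (hfin (n : ℤ)).toFinset

/-- `K_n` as a `Finset`. -/
noncomputable def KFinset (G : GradedPoset P)
    (hfin : ∀ i : ℤ, {p : P | G.deg p = i}.Finite) (K : ℕ → Set P) (n : ℕ) : Finset P :=
  ((hfin (n : ℤ)).inter_of_left (K n)).toFinset

/-- The Betti numbers `b_n^𝒦` of a global covering family (Definition 5.2). -/
noncomputable def bettiK (G : GradedPoset P)
    (hfin : ∀ i : ℤ, {p : P | G.deg p = i}.Finite) (K : ℕ → Set P) : ℕ → ℤ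
  | 0 => ∑ p ∈ KFinset G hfin K 0, Rnum G 0 p
  | n + 1 =>
      (∑ p ∈ KFinset G hfin K n, Rnum G n p) - (∑ p ∈ obFinset G hfin n, Rnum G n p) +
        ∑ p ∈ KFinset G hfin K (n + 1), Rnum G (n + 1) p

/-- The sequence of functors `F_0 = c_ℤ, F_1, F_2, …` of Proposition 4.3, together with
the connecting short exact sequences `0 → F_{n-1} → Ker'_{F_{n-1}} → F_n → 0` and all
their properties. -/
structure CondensedSequence (G : GradedPoset P) (J : P → ℕ → Set P) : Type 1 where
  F : ℕ → PosetFunctor P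
  pi : ∀ n : ℕ, PosetHom (kerPrime G (F n) n) (F (n + 1))
  F_zero : F 0 = constZ P
  pi_surj : ∀ (n : ℕ) (p : P), Function.Surjective ((pi n).app p)
  pi_ker : ∀ (n : ℕ) (p : P), ((pi n).app p).ker = ((lambdaNT G (F n) n).app p).range
  condensed : ∀ n : ℕ, IsCondensed G (F n) n
  free : ∀ n : ℕ, IsFreeFunctor (F n)
  determined : ∀ n : ℕ, IsDetermined G J (F n) n
  rank_eq : ∀ (n : ℕ) (p : P), (n : ℤ) ≤ G.deg p →
    (Module.finrank ℤ ((F n).obj p) : ℤ) = Rnum G n p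

/-! ### Simplex-like posets -/

/-- The poset `Δ_n` of faces of the standard `n`-dimensional simplex, ordered by
inclusion: faces are the nonempty subsets of the vertex set. -/
def SimplexPoset (n : ℕ) : Type := {s : Finset (Fin (n + 1)) // s.Nonempty}

instance (n : ℕ) : PartialOrder (SimplexPoset n) := Subtype.partialOrder _

/-- A poset `P` is simplex-like (with dimension function `d`) if for every `p` the
category `(P ↓ p)` is isomorphic to `Δ_{d p}`. -/
def SimplexLike (P : Type) [PartialOrder P] (d : P → ℕ) : Prop :=
  ∀ p : P, Nonempty ({q : P // q ≤ p} ≃o SimplexPoset (d p))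

theorem deg_strict_aux (G : GradedPoset P) {p q : P} (h : p < q) : G.deg q < G.deg p := by
  have hfin : {r : P | p < r ∧ r ≤ q}.Finite :=
    (G.finite_up p).subset (fun r hr => hr.1.le)
  obtain ⟨r, hr⟩ := hfin.exists_minimal ⟨q, h, le_refl q⟩
  have hstep : G.deg p = G.deg r + 1 := by
    apply G.deg_step hr.prop.1
    intro t ht1 ht2
    rcases ht1.eq_or_lt with e | l
    · exact Or.inl e.symm
    · exact Or.inr (le_antisymm ht2 (hr.le_of_le ⟨l, ht2.trans hr.prop.2⟩ ht2))
  have := G.deg_antitone hr.prop.2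
  omega

theorem lambda_inj_aux (G : GradedPoset P) (F : PosetFunctor P) (n : ℕ)
    (hF : IsCondensed G F n) : ∀ (m : ℕ) (p : P), G.deg p ≤ (m : ℤ) → ∀ x : F.obj p,
      (∀ (q : P) (h : p ≤ q), G.deg q = (n : ℤ) → F.map h x = 0) → x = 0 := by
  intro m
  induction m with
  | zero =>
    intro p hp x hx
    rcases lt_trichotomy (G.deg p) (n : ℤ) with h | h | h
    · exact hF.1 p h x
    · rw [← F.map_id p x]; exact hx p le_rfl h
    · have := G.deg_nonneg p
      push_cast at hp
      omega
  | succ m ih =>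
    intro p hp x hx
    rcases lt_trichotomy (G.deg p) (n : ℤ) with h | h | h
    · exact hF.1 p h x
    · rw [← F.map_id p x]; exact hx p le_rfl h
    · apply hF.2 p h x
      intro q hq
      apply ih q
      · have := deg_strict_aux G hq
        push_cast at hp
        omega
      · intro r hr hd
        rw [F.map_comp]
        exact hx r _ hd

theorem lambda_inj (G : GradedPoset P) (F : PosetFunctor P) (n : ℕ)
    (hF : IsCondensed G F n) (p : P) (x y : F.obj p)
    (hxy : ∀ (q : P) (h : p ≤ q), G.deg q = (n : ℤ) → F.map h x = F.map h y) : x = y := by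
  rw [← sub_eq_zero]
  apply lambda_inj_aux G F n hF (G.deg p).toNat p (Int.self_le_toNat _)
  intro q h hd
  rw [map_sub, hxy q h hd, sub_self]

/-- **Lemma 2.10.** Let `F : 𝒫 → Ab` be an `n`-condensed functor on a graded poset `𝒫`,
with short exact sequence `0 → F → Ker'_F → G → 0`. Then `G` is `(n+1)`-condensed if and
only if for each object `p₀` of degree greater than `n+1` the natural map
`F(p₀) → lim_{(p₀↓𝒫)_*} F` is an isomorphism. -/
theorem lemma_2_10 {P : Type} [PartialOrder P] (G : GradedPoset P) (F : PosetFunctor P)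
    (n : ℕ) (hF : IsCondensed G F n)
    (Gf : PosetFunctor P) (π : PosetHom (kerPrime G F n) Gf)
    (hsurj : ∀ p₀ : P, Function.Surjective (π.app p₀))
    (hker : ∀ p₀ : P, (π.app p₀).ker = ((lambdaNT G F n).app p₀).range) :
    IsCondensed G Gf (n + 1) ↔
      ∀ p₀ : P, (n : ℤ) + 1 < G.deg p₀ →
        Function.Bijective (fun x : F.obj p₀ =>
          (⟨fun q => F.map (le_of_lt q.2) x, by
              intro q r h
              rw [F.map_comp]⟩ :
            ↥(sectionsOnSet F {q : P | p₀ < q}))) := by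
  have hker' : ∀ (p : P) (y : (kerPrime G F n).obj p), π.app p y = 0 ↔
      ∃ x : F.obj p, ∀ q : degSet G p n, F.map q.2.1 x = y q := by
    intro p y
    rw [← AddMonoidHom.mem_ker, hker p, AddMonoidHom.mem_range]
    exact ⟨fun ⟨x, hx⟩ => ⟨x, fun q => congrFun hx q⟩, fun ⟨x, hx⟩ => ⟨x, funext hx⟩⟩
  constructor
  · intro hG p hp
    constructor
    · intro x y hxy
      have h1 := congrArg Subtype.val hxy
      rw [← sub_eq_zero]
      apply hF.2 p (by omega)
      intro q hq
      rw [map_sub, sub_eq_zero]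
      exact congrFun h1 ⟨q, hq⟩
    · rintro ⟨s, hs⟩
      have hlt : ∀ q : degSet G p n, p < q.1 := by
        intro q
        rcases q.2.1.eq_or_lt with e | l
        · have := q.2.2
          rw [← e] at this
          omega
        · exact l
      have hy : π.app p (fun q => s ⟨q.1, hlt q⟩) = 0 := by
        apply hG.2 p (by push_cast; omega)
        intro q hq
        refine (π.naturality hq.le _).trans ((hker' q _).2 ?_)
        exact ⟨s ⟨q, hq⟩, fun r => hs ⟨q, hq⟩ ⟨r.1, lt_of_lt_of_le hq r.2.1⟩ r.2.1⟩
      obtain ⟨x, hx⟩ := (hker' p _).1 hy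
      refine ⟨x, Subtype.ext (funext fun q => ?_)⟩
      apply lambda_inj G F n hF
      intro r hr hd
      rw [F.map_comp]
      have h1 := hs q ⟨r, lt_of_lt_of_le q.2 hr⟩ hr
      rw [h1]
      exact hx ⟨r, q.2.le.trans hr, hd⟩
  · intro hB
    constructor
    · intro p hp z
      obtain ⟨y, rfl⟩ := hsurj p z
      rw [hker']
      have heq : ∀ q : degSet G p n, p = q.1 := by
        intro q
        rcases q.2.1.eq_or_lt with e | l
        · exact e
        · have h1 := deg_strict_aux G l
          have h2 := q.2.2
          push_cast at hp
          omega
      by_cases hd : G.deg p = (n : ℤ)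
      · refine ⟨y ⟨p, le_rfl, hd⟩, ?_⟩
        rintro ⟨q, hq⟩
        obtain rfl : p = q := heq ⟨q, hq⟩
        exact F.map_id _ _
      · refine ⟨0, fun q => absurd ?_ hd⟩
        rw [heq q]
        exact q.2.2
    · intro p hp z hz
      obtain ⟨y, rfl⟩ := hsurj p z
      have hex : ∀ q : {q : P | p < q}, ∃ x : F.obj q.1, ∀ r : degSet G q.1 n,
          F.map r.2.1 x = y ⟨r.1, q.2.le.trans r.2.1, r.2.2⟩ := by
        intro q
        have h1 := hz q.1 q.2
        rw [π.naturality, hker'] at h1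
        exact h1
      choose s hs using hex
      push_cast at hp
      obtain ⟨x, hx⟩ := (hB p hp).2 ⟨s, by
        intro q r h
        apply lambda_inj G F n hF
        intro t ht hd
        rw [F.map_comp]
        exact (hs q ⟨t, h.trans ht, hd⟩).trans (hs r ⟨t, ht, hd⟩).symm⟩
      have hx' := congrArg Subtype.val hx
      rw [hker']
      refine ⟨x, fun q => ?_⟩
      have hl : p < q.1 := by
        rcases q.2.1.eq_or_lt with e | l
        · have := q.2.2
          rw [← e] at this
          omega
        · exact l
      have h1 : F.map hl.le x = s ⟨q.1, hl⟩ := congrFun hx' ⟨q.1, hl⟩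
      have h2 := hs ⟨q.1, hl⟩ ⟨q.1, le_rfl, q.2.2⟩
      rw [F.map_id] at h2
      exact h1.trans h2
end

section
/- If 𝒫 is a simplex-like poset, then there exists an adequate local covering family for the graded poset 𝒫^op. -/
open Finset

variable {P : Type} [PartialOrder P]

/-- Vertex data of a simplex-like poset: `vs p` is the finite set of vertices of `p`. -/
theorem simplexLike_vertices {P : Type} [PartialOrder P] (d : P → ℕ) (h : SimplexLike P d) :
    ∃ vs : P → Finset P, (∀ p v, v ∈ vs p ↔ v ≤ p ∧ IsMin v) ∧
      (∀ p, (vs p).card = d p + 1) ∧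
      (∀ p q r, q ≤ p → r ≤ p → vs q ⊆ vs r → q ≤ r) ∧
      (∀ p (S : Finset P), S.Nonempty → S ⊆ vs p → ∃ q, q ≤ p ∧ vs q = S) := by
  classical
  have key : ∀ p : P, ∃ (f : Fin (d p + 1) → P) (E : P → Finset (Fin (d p + 1))),
      Function.Injective f ∧ E p = Finset.univ ∧
      (∀ q, q ≤ p → ∀ v, (v ≤ q ∧ IsMin v) ↔ v ∈ (E q).image f) ∧
      (∀ q r, q ≤ p → r ≤ p → E q ⊆ E r → q ≤ r) ∧
      (∀ S : Finset (Fin (d p + 1)), S.Nonempty → ∃ q, q ≤ p ∧ E q = S) := by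
    intro p
    obtain ⟨e⟩ := h p
    have hle : ∀ a b : SimplexPoset (d p), a ≤ b ↔ a.1 ⊆ b.1 := fun a b => Iff.rfl
    let sg : Fin (d p + 1) → SimplexPoset (d p) := fun i => ⟨{i}, Finset.singleton_nonempty i⟩
    let f : Fin (d p + 1) → P := fun i => (e.symm (sg i)).1
    let E : P → Finset (Fin (d p + 1)) := fun q => if hq : q ≤ p then (e ⟨q, hq⟩).1 else ∅
    have hE : ∀ q (hq : q ≤ p), E q = (e ⟨q, hq⟩).1 := fun q hq => by simp [E, hq]
    have hfp : ∀ i, f i ≤ p := fun i => (e.symm (sg i)).2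
    have hEf : ∀ i, E (f i) = {i} := by
      intro i
      rw [hE _ (hfp i)]
      have : (⟨f i, hfp i⟩ : {q : P // q ≤ p}) = e.symm (sg i) := rfl
      rw [this, e.apply_symm_apply]
    have hEle : ∀ q r, q ≤ p → r ≤ p → (q ≤ r ↔ E q ⊆ E r) := by
      intro q r hq hr
      rw [hE q hq, hE r hr, ← hle, e.le_iff_le]
      rfl
    have hEne : ∀ q, q ≤ p → (E q).Nonempty := fun q hq => by
      rw [hE q hq]; exact (e ⟨q, hq⟩).2
    have hsurj : ∀ S : Finset (Fin (d p + 1)), S.Nonempty → ∃ q, q ≤ p ∧ E q = S := by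
      intro S hS
      refine ⟨(e.symm ⟨S, hS⟩).1, (e.symm ⟨S, hS⟩).2, ?_⟩
      rw [hE _ (e.symm ⟨S, hS⟩).2]
      exact congrArg Subtype.val (e.apply_symm_apply ⟨S, hS⟩)
    refine ⟨f, E, ?_, ?_, ?_, fun q r hq hr => (hEle q r hq hr).2, hsurj⟩
    · intro i j hij
      have := hEf i
      rw [hij, hEf j] at this
      exact (Finset.singleton_injective this).symm
    · obtain ⟨q, hq, hqu⟩ := hsurj Finset.univ Finset.univ_nonempty
      have := (hEle q p hq le_rfl).1 hq
      rw [hqu] at this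
      exact Finset.univ_subset_iff.1 this
    · intro q hq v
      rw [Finset.mem_image]
      constructor
      · rintro ⟨hv, hmin⟩
        obtain ⟨i, hi⟩ := hEne v (hv.trans hq)
        have h1 : f i ≤ v := (hEle _ _ (hfp i) (hv.trans hq)).2 (by rw [hEf]; simpa using hi)
        have h2 : f i = v := le_antisymm h1 (hmin h1)
        exact ⟨i, (hEle v q (hv.trans hq) hq).1 hv hi, h2⟩
      · rintro ⟨i, hi, rfl⟩
        refine ⟨(hEle _ _ (hfp i) hq).2 (by rw [hEf]; simpa using hi), ?_⟩
        intro b hb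
        have hbp := hb.trans (hfp i)
        refine (hEle _ _ (hfp i) hbp).2 ?_
        have h1 := (hEle _ _ hbp (hfp i)).1 hb
        rw [hEf] at h1 ⊢
        rcases Finset.subset_singleton_iff.1 h1 with h2 | h2
        · exact absurd h2 (hEne b hbp).ne_empty
        · rw [h2]
  choose f E hf hEp hEm hEle hEs using key
  let vs : P → Finset P := fun p => (E p p).image (f p)
  have hvs : ∀ p v, v ∈ vs p ↔ v ≤ p ∧ IsMin v := fun p v => (hEm p p le_rfl v).symm
  have hvs2 : ∀ p q, q ≤ p → vs q = (E p q).image (f p) := by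
    intro p q hq
    ext v
    rw [hvs, hEm p q hq]
  refine ⟨vs, hvs, ?_, ?_, ?_⟩
  · intro p
    simp only [vs]
    rw [Finset.card_image_of_injective _ (hf p), hEp]
    simp
  · intro p q r hq hr hs
    rw [hvs2 p q hq, hvs2 p r hr, Finset.image_subset_image_iff (hf p)] at hs
    exact hEle p q r hq hr hs
  · intro p S hS hSp
    obtain ⟨T, -, rfl⟩ := Finset.subset_image_iff.1 hSp
    obtain ⟨q, hq, hqT⟩ := hEs p T (Finset.image_nonempty.1 hS)
    exact ⟨q, hq, by rw [hvs2 p q hq, hqT]⟩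

/-- **Lemma 6.5.** If `𝒫` is a simplex-like poset then there is an adequate local
covering family for the graded poset `𝒫^op`. -/
theorem lemma_6_5 {P : Type} [PartialOrder P] (d : P → ℕ) (h : SimplexLike P d)
    (G : GradedPoset Pᵒᵈ)
    (hdeg : ∀ p : Pᵒᵈ, G.deg p = (d (OrderDual.ofDual p) : ℤ)) :
    ∃ J : Pᵒᵈ → ℕ → Set Pᵒᵈ, IsAdequate G J := by
  classical
  obtain ⟨vs, hvs, hcard, hsub, hex⟩ := simplexLike_vertices d h
  have hmono : ∀ p q, q ≤ p → vs q ⊆ vs p := by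
    intro p q hq v hv
    rw [hvs] at hv ⊢
    exact ⟨hv.1.trans hq, hv.2⟩
  have hinj : ∀ p q r, q ≤ p → r ≤ p → vs q = vs r → q = r := fun p q r hq hr he =>
    le_antisymm (hsub p q r hq hr he.subset) (hsub p r q hr hq he.symm.subset)
  have hne : ∀ p, (vs p).Nonempty := fun p => by
    rw [← Finset.card_pos, hcard]; omega
  -- the chosen vertex
  obtain ⟨mn, hmn, hmnle⟩ : ∃ mn : P → P, (∀ p, mn p ∈ vs p) ∧
      ∀ p, ∀ v ∈ vs p, embeddingToCardinal (mn p) ≤ embeddingToCardinal v := by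
    choose mn h1 h2 using fun p => Finset.exists_min_image (vs p)
      (fun v => embeddingToCardinal v) (hne p)
    exact ⟨mn, h1, h2⟩
  have hmneq : ∀ p r, r ≤ p → mn p ∈ vs r → mn r = mn p := by
    intro p r hr hm
    exact embeddingToCardinal.injective
      (le_antisymm (hmnle r _ hm) (hmnle p _ (hmono p r hr (hmn r))))
  have hmemdeg : ∀ (p q : P) (m : ℕ), OrderDual.toDual q ∈ degSet G (OrderDual.toDual p) m ↔
      q ≤ p ∧ (vs q).card = m + 1 := by
    intro p q m
    have : OrderDual.toDual q ∈ degSet G (OrderDual.toDual p) m ↔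
      OrderDual.toDual p ≤ OrderDual.toDual q ∧ G.deg (OrderDual.toDual q) = (m : ℤ) := Iff.rfl
    rw [this, hdeg, OrderDual.toDual_le_toDual, hcard, OrderDual.ofDual_toDual]
    simp
  -- number of faces
  have hfaces : ∀ (p : P) (m : ℕ),
      (degFinset G (OrderDual.toDual p) m).card = (d p + 1).choose (m + 1) := by
    intro p m
    rw [← hcard p, ← Finset.card_powersetCard]
    refine Finset.card_bij (fun q _ => vs (OrderDual.ofDual q)) ?_ ?_ ?_
    · intro q hq
      have hq' := (hmemdeg p (OrderDual.ofDual q) m).1 (by simpa [degFinset] using hq)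
      rw [Finset.mem_powersetCard]
      exact ⟨hmono _ _ hq'.1, hq'.2⟩
    · intro q hq r hr he
      have hq' := (hmemdeg p (OrderDual.ofDual q) m).1 (by simpa [degFinset] using hq)
      have hr' := (hmemdeg p (OrderDual.ofDual r) m).1 (by simpa [degFinset] using hr)
      exact hinj p _ _ hq'.1 hr'.1 he
    · intro S hS
      rw [Finset.mem_powersetCard] at hS
      obtain ⟨q, hq, hqS⟩ := hex p S (Finset.card_pos.1 (by omega)) hS.1
      refine ⟨OrderDual.toDual q, ?_, hqS⟩
      have := (hmemdeg p q m).2 ⟨hq, by rw [hqS]; exact hS.2⟩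
      simpa [degFinset] using this
  -- the numbers R
  have hR : ∀ (m : ℕ) (p : P), Rnum G m (OrderDual.toDual p) = ((d p).choose m : ℤ) := by
    intro m
    induction m with
    | zero => intro p; simp [Rnum]
    | succ m ih =>
      intro p
      have h1 : ∀ q ∈ degFinset G (OrderDual.toDual p) m, Rnum G m q = 1 := by
        intro q hq
        have hq' := (hmemdeg p (OrderDual.ofDual q) m).1 (by simpa [degFinset] using hq)
        have h2 := ih (OrderDual.ofDual q)
        rw [hcard] at hq'
        have h3 : d (OrderDual.ofDual q) = m := by omega
        rw [h3] at h2
        simpa using h2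
      rw [Rnum, Finset.sum_congr rfl h1, ih p, Finset.sum_const, hfaces,
        Nat.choose_succ_succ (d p) m]
      simp
  let J : Pᵒᵈ → ℕ → Set Pᵒᵈ := fun p m =>
    {q | q ∈ degSet G p m ∧ mn (OrderDual.ofDual p) ∈ vs (OrderDual.ofDual q)}
  have hJmem : ∀ (p q : P) (m : ℕ), OrderDual.toDual q ∈ J (OrderDual.toDual p) m ↔
      (q ≤ p ∧ (vs q).card = m + 1) ∧ mn p ∈ vs q := by
    intro p q m
    rw [← hmemdeg]
    rfl
  have hJF : ∀ (p q : P) (m : ℕ), OrderDual.toDual q ∈ JFinset G J (OrderDual.toDual p) m ↔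
      (q ≤ p ∧ (vs q).card = m + 1) ∧ mn p ∈ vs q := by
    intro p q m
    rw [← hJmem]
    simp only [JFinset, Set.Finite.mem_toFinset]
    exact ⟨fun h => h.2, fun h => ⟨h.1.1, h⟩⟩
  have hJcard : ∀ (p : P) (m : ℕ),
      (JFinset G J (OrderDual.toDual p) m).card = (d p).choose m := by
    intro p m
    have h0 : ((vs p).erase (mn p)).card = d p := by
      rw [Finset.card_erase_of_mem (hmn p), hcard]; omega
    rw [← h0, ← Finset.card_powersetCard]
    refine Finset.card_bij (fun q _ => (vs (OrderDual.ofDual q)).erase (mn p)) ?_ ?_ ?_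
    · intro q hq
      obtain ⟨⟨h1, h2⟩, h3⟩ := (hJF p (OrderDual.ofDual q) m).1 hq
      rw [Finset.mem_powersetCard]
      refine ⟨Finset.erase_subset_erase _ (hmono _ _ h1), ?_⟩
      rw [Finset.card_erase_of_mem h3, h2]; omega
    · intro q hq r hr he
      obtain ⟨⟨h1, h2⟩, h3⟩ := (hJF p (OrderDual.ofDual q) m).1 hq
      obtain ⟨⟨h1', h2'⟩, h3'⟩ := (hJF p (OrderDual.ofDual r) m).1 hr
      refine hinj p (OrderDual.ofDual q) (OrderDual.ofDual r) h1 h1' ?_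
      rw [← Finset.insert_erase h3, ← Finset.insert_erase h3']
      exact congrArg (insert (mn p)) he
    · intro S hS
      rw [Finset.mem_powersetCard] at hS
      have hnot : mn p ∉ S := fun hm => by simpa using hS.1 hm
      obtain ⟨q, hq, hqS⟩ := hex p (insert (mn p) S) (Finset.insert_nonempty _ _)
        (Finset.insert_subset (hmn p) (hS.1.trans (Finset.erase_subset _ _)))
      refine ⟨OrderDual.toDual q, (hJF p q m).2 ⟨⟨hq, ?_⟩, ?_⟩, ?_⟩
      · rw [hqS, Finset.card_insert_of_notMem hnot, hS.2]
      · rw [hqS]; exact Finset.mem_insert_self _ _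
      · rw [OrderDual.ofDual_toDual, hqS, Finset.erase_insert hnot]
  refine ⟨J, ⟨fun p m q hq => hq.1, ?_, ?_⟩, ?_, ?_⟩
  · intro p m hm
    rw [hdeg] at hm
    have hm' : m < d (OrderDual.ofDual p) := by exact_mod_cast hm
    ext q
    simp only [Set.mem_iUnion, exists_prop]
    constructor
    · rintro ⟨r, hr, hq⟩
      exact ⟨hr.1.1.trans hq.1, hq.2⟩
    · intro hq
      obtain ⟨h1, h2⟩ := (hmemdeg (OrderDual.ofDual p) (OrderDual.ofDual q) m).1 hq
      set p' := OrderDual.ofDual p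
      set q' := OrderDual.ofDual q
      obtain ⟨T, hT1, hT2, hT3⟩ := Finset.exists_subsuperset_card_eq
        (s := insert (mn p') (vs q')) (t := vs p') (n := m + 2)
        (Finset.insert_subset (hmn p') (hmono _ _ h1))
        ((Finset.card_insert_le _ _).trans (by omega)) (by rw [hcard]; omega)
      obtain ⟨r, hr, hrT⟩ := hex p' T (Finset.card_pos.1 (by omega)) hT2
      refine ⟨OrderDual.toDual r, (hJmem p' r (m + 1)).2 ⟨⟨hr, by rw [hrT, hT3]⟩, ?_⟩,
        (hmemdeg r q' m).2 ⟨hsub p' q' r h1 hr ?_, h2⟩⟩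
      · rw [hrT]; exact hT1 (Finset.mem_insert_self _ _)
      · rw [hrT]; exact (Finset.subset_insert _ _).trans hT1
  · intro p m r hr q hq
    obtain ⟨⟨h1, h2⟩, h3⟩ := (hJmem (OrderDual.ofDual p) (OrderDual.ofDual r) (m + 1)).1 hr
    refine ⟨⟨hr.1.1.trans hq.1.1, hq.1.2⟩, ?_⟩
    rw [← hmneq _ _ h1 h3]
    exact hq.2
  · intro p hp
    rw [hdeg] at hp
    have hp' : 2 ≤ d (OrderDual.ofDual p) := by exact_mod_cast hp
    set p' := OrderDual.ofDual p with hp'def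
    have hsmall : ∀ v ∈ vs p', ∀ w ∈ vs p', ∃ e : P, e < p' ∧ v ≤ e ∧ w ≤ e := by
      intro v hv w hw
      obtain ⟨e, he, hes⟩ := hex p' {v, w} (Finset.insert_nonempty _ _)
        (by intro x hx; simp only [Finset.mem_insert, Finset.mem_singleton] at hx
            rcases hx with rfl | rfl <;> assumption)
      refine ⟨e, lt_of_le_of_ne he ?_, ((hvs e v).1 (by rw [hes]; simp)).1,
        ((hvs e w).1 (by rw [hes]; simp)).1⟩
      intro heq
      have h1 := hcard e
      have h3 : d e = d p' := by rw [heq]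
      have h2 := Finset.card_le_two (a := v) (b := w)
      rw [hes] at h1
      omega
    have hlt : ∀ x : P, x < p' → p < OrderDual.toDual x := fun x hx => hx
    constructor
    · obtain ⟨v, hv⟩ := hne p'
      obtain ⟨e, he, -⟩ := hsmall v hv v hv
      exact ⟨OrderDual.toDual e, hlt e he⟩
    · rintro ⟨a, ha⟩ ⟨b, hb⟩
      have ha' : OrderDual.ofDual a < p' := ha
      have hb' : OrderDual.ofDual b < p' := hb
      obtain ⟨v, hv⟩ := hne (OrderDual.ofDual a)
      obtain ⟨w, hw⟩ := hne (OrderDual.ofDual b)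
      obtain ⟨e, he, hve, hwe⟩ := hsmall v (hmono _ _ ha'.le hv) w (hmono _ _ hb'.le hw)
      have hva := ((hvs _ _).1 hv).1
      have hwb := ((hvs _ _).1 hw).1
      have s1 : p < OrderDual.toDual v := hlt v (hva.trans_lt ha')
      have s2 : p < OrderDual.toDual w := hlt w (hwb.trans_lt hb')
      let A : {q : Pᵒᵈ | p < q} := ⟨a, ha⟩
      let B : {q : Pᵒᵈ | p < q} := ⟨b, hb⟩
      let V : {q : Pᵒᵈ | p < q} := ⟨OrderDual.toDual v, s1⟩
      let W : {q : Pᵒᵈ | p < q} := ⟨OrderDual.toDual w, s2⟩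
      let X : {q : Pᵒᵈ | p < q} := ⟨OrderDual.toDual e, hlt e he⟩
      let ρ : {q : Pᵒᵈ | p < q} → {q : Pᵒᵈ | p < q} → Prop :=
        fun x y => x.1 ≤ y.1 ∨ y.1 ≤ x.1
      have r1 : ρ A V := Or.inl hva
      have r2 : ρ V X := Or.inr hve
      have r3 : ρ X W := Or.inl hwe
      have r4 : ρ W B := Or.inr hwb
      exact (((Relation.ReflTransGen.single r1).tail r2).tail r3).tail r4
  · intro m p hp
    have h1 : ∀ q ∈ JFinset G J p m, Rnum G m q = 1 := by
      intro q hq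
      have hq' := ((hJF (OrderDual.ofDual p) (OrderDual.ofDual q) m).1 hq).1
      have h2 := hR m (OrderDual.ofDual q)
      rw [hcard] at hq'
      have h3 : d (OrderDual.ofDual q) = m := by omega
      rw [h3] at h2
      simpa using h2
    have h2 := hJcard (OrderDual.ofDual p) m
    have h3 := hR m (OrderDual.ofDual p)
    rw [OrderDual.toDual_ofDual] at h2 h3
    rw [Finset.sum_congr rfl h1, Finset.sum_const, h2, h3]
    simp
end

section
/- Let 𝒫 be a finite simplicial complex (regarded as a simplex-like poset of simplices) and f : 𝒫 → ℝ a discrete Morse function. Then the family 𝒦 = {K_n}_{n≥0} with K_n = C_n ∪ D_n, where C_n is the set of critical n-simplices and D_n = {p^n | there exists exactly one (n−1)-face q < p with f(p) ≤ f(q)}, is a global covering family for 𝒫^op, and for each n ≥ 0 its Betti number b_n^𝒦 equals the number of critical simplices of dimension n. -/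
open Finset

variable {P : Type} [PartialOrder P]

/-- The set `{q^{n+1} > p | f q ≤ f p}` for a simplex `p` of dimension `n = d p`. -/
def upSetMorse {P : Type} [PartialOrder P] (d : P → ℕ) (f : P → ℝ) (p : P) : Set P :=
  {q : P | p < q ∧ d q = d p + 1 ∧ f q ≤ f p}

/-- The set `{q^{n-1} < p | f p ≤ f q}` for a simplex `p` of dimension `n = d p`. -/
def downSetMorse {P : Type} [PartialOrder P] (d : P → ℕ) (f : P → ℝ) (p : P) : Set P :=
  {q : P | q < p ∧ d p = d q + 1 ∧ f p ≤ f q}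

/-- A discrete Morse function on a simplicial complex (viewed as a poset of simplices
with dimension function `d`). -/
def IsMorse {P : Type} [PartialOrder P] (d : P → ℕ) (f : P → ℝ) : Prop :=
  ∀ p : P, (upSetMorse d f p).ncard ≤ 1 ∧ (downSetMorse d f p).ncard ≤ 1

/-- A simplex is critical when both exceptional sets are empty. -/
def IsCritical {P : Type} [PartialOrder P] (d : P → ℕ) (f : P → ℝ) (p : P) : Prop :=
  upSetMorse d f p = ∅ ∧ downSetMorse d f p = ∅

/-- The family `𝒦` with `K_n = C_n ∪ D_n`, where `C_n` is the set of critical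
`n`-simplices and `D_n` the set of `n`-simplices having exactly one `(n−1)`-face `q`
with `f p ≤ f q` (as a family of subsets of objects of `𝒫^op`). -/
def morseK {P : Type} [PartialOrder P] (d : P → ℕ) (f : P → ℝ) (n : ℕ) : Set (Pᵒᵈ) :=
  {p : Pᵒᵈ | d (OrderDual.ofDual p) = n ∧
    (IsCritical d f (OrderDual.ofDual p) ∨
      (downSetMorse d f (OrderDual.ofDual p)).ncard = 1)}

section Prop72Comb

theorem simplexPoset_card_below (N : ℕ) (t : SimplexPoset N) :
    Nat.card {s : SimplexPoset N // s ≤ t} + 1 = 2 ^ t.1.card := by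
  have e : {s : SimplexPoset N // s ≤ t} ≃ ↥(t.1.powerset.erase ∅) :=
    { toFun := fun s => ⟨s.1.1, Finset.mem_erase.2
        ⟨s.1.2.ne_empty, Finset.mem_powerset.2 s.2⟩⟩
      invFun := fun s => ⟨⟨s.1, Finset.nonempty_iff_ne_empty.2 (Finset.mem_erase.1 s.2).1⟩,
        Finset.mem_powerset.1 (Finset.mem_erase.1 s.2).2⟩
      left_inv := fun _ => rfl
      right_inv := fun _ => rfl }
  rw [Nat.card_congr e, Nat.card_eq_fintype_card, Fintype.card_coe,
    Finset.card_erase_of_mem (by simp), Finset.card_powerset]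
  have : 0 < 2 ^ t.1.card := by positivity
  omega

theorem simplexPoset_card (N : ℕ) : Nat.card (SimplexPoset N) + 1 = 2 ^ (N + 1) := by
  have h := simplexPoset_card_below N ⟨Finset.univ, Finset.univ_nonempty⟩
  rw [Finset.card_univ, Fintype.card_fin] at h
  rw [← h]
  congr 1
  exact Nat.card_congr
    { toFun := fun s => ⟨s, Finset.subset_univ _⟩
      invFun := fun s => s.1
      left_inv := fun _ => rfl
      right_inv := fun _ => rfl }

theorem simplexLike_card {P : Type} [PartialOrder P] {d : P → ℕ} (hsl : SimplexLike P d)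
    {p : P} (e : {q : P // q ≤ p} ≃o SimplexPoset (d p)) (q : {q : P // q ≤ p}) :
    (e q).1.card = d q.1 + 1 := by
  obtain ⟨e'⟩ := hsl q.1
  have e'' : {r : P // r ≤ q.1} ≃ {s : SimplexPoset (d p) // s ≤ e q} :=
    { toFun := fun r => ⟨e ⟨r.1, r.2.trans q.2⟩, e.monotone (show r.1 ≤ q.1 from r.2)⟩
      invFun := fun s => ⟨(e.symm s.1).1, by
        have : e.symm s.1 ≤ q := by
          rw [e.symm_apply_le]; exact s.2
        exact this⟩
      left_inv := fun r => by simp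
      right_inv := fun s => by simp }
  have h1 := simplexPoset_card_below (d p) (e q)
  have h2 := simplexPoset_card (d q.1)
  rw [← Nat.card_congr e'', Nat.card_congr e'.toEquiv, h2] at h1
  exact (Nat.pow_right_injective (le_refl 2) h1).symm

theorem simplexLike_diamond {P : Type} [PartialOrder P] {d : P → ℕ} (hsl : SimplexLike P d)
    {p q₁ q₂ : P} {m : ℕ} (hp : d p = m + 2) (h1 : q₁ ≤ p) (h2 : q₂ ≤ p)
    (d1 : d q₁ = m + 1) (d2 : d q₂ = m + 1) (hne : q₁ ≠ q₂) :
    ∃ r, r ≤ q₁ ∧ r ≤ q₂ ∧ d r = m ∧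
      ∀ q, q ≤ p → r ≤ q → d q = m + 1 → q = q₁ ∨ q = q₂ := by
  obtain ⟨e⟩ := hsl p
  have c1 := simplexLike_card hsl e ⟨q₁, h1⟩
  have c2 := simplexLike_card hsl e ⟨q₂, h2⟩
  simp only [d1, d2] at c1 c2
  have hne' : (e ⟨q₁, h1⟩).1 ≠ (e ⟨q₂, h2⟩).1 := by
    intro h
    have := e.injective (Subtype.ext h)
    exact hne (congrArg Subtype.val this)
  generalize hs1 : (e ⟨q₁, h1⟩) = s1 at *
  generalize hs2 : (e ⟨q₂, h2⟩) = s2 at *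
  have hu : (s1.1 ∪ s2.1).card ≤ m + 3 := by
    have := Finset.card_le_univ (s1.1 ∪ s2.1)
    rw [Fintype.card_fin] at this
    omega
  have hu2 : m + 2 < (s1.1 ∪ s2.1).card := by
    by_contra hcon
    have e1 := Finset.eq_of_subset_of_card_le (Finset.subset_union_left (s₁ := s1.1) (s₂ := s2.1))
      (by omega)
    have e2 := Finset.eq_of_subset_of_card_le (Finset.subset_union_right (s₁ := s1.1) (s₂ := s2.1))
      (by omega)
    exact hne' (e1.trans e2.symm)
  have hi := Finset.card_union_add_card_inter s1.1 s2.1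
  have hic : (s1.1 ∩ s2.1).card = m + 1 := by omega
  have hin : (s1.1 ∩ s2.1).Nonempty := Finset.card_pos.1 (by omega)
  have huniv : s1.1 ∪ s2.1 = Finset.univ := by
    apply Finset.eq_univ_of_card
    rw [Fintype.card_fin]; omega
  let t : SimplexPoset (d p) := ⟨s1.1 ∩ s2.1, hin⟩
  have ht1 : e.symm t ≤ ⟨q₁, h1⟩ := by
    rw [e.symm_apply_le, hs1]; exact Finset.inter_subset_left
  have ht2 : e.symm t ≤ ⟨q₂, h2⟩ := by
    rw [e.symm_apply_le, hs2]; exact Finset.inter_subset_right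
  refine ⟨(e.symm t).1, ht1, ht2, ?_, ?_⟩
  · have := simplexLike_card hsl e (e.symm t)
    rw [e.apply_symm_apply] at this
    change (s1.1 ∩ s2.1).card = _ at this
    omega
  · intro q hq hr hd
    have c := simplexLike_card hsl e ⟨q, hq⟩
    simp only [hd] at c
    have hsub : t ≤ e ⟨q, hq⟩ := by
      rw [← e.symm_apply_le]; exact hr
    have hsub' : s1.1 ∩ s2.1 ⊆ (e ⟨q, hq⟩).1 := hsub
    obtain ⟨a, ha, hat⟩ := Finset.exists_mem_notMem_of_card_lt_card
      (show (s1.1 ∩ s2.1).card < (e ⟨q, hq⟩).1.card by omega)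
    have hins : insert a (s1.1 ∩ s2.1) = (e ⟨q, hq⟩).1 := by
      apply Finset.eq_of_subset_of_card_le
      · exact Finset.insert_subset ha hsub'
      · rw [Finset.card_insert_of_notMem hat]; omega
    have hau : a ∈ s1.1 ∪ s2.1 := by rw [huniv]; exact Finset.mem_univ _
    rcases Finset.mem_union.1 hau with h | h
    · left
      have : (e ⟨q, hq⟩).1 = s1.1 := by
        rw [← hins]
        apply Finset.eq_of_subset_of_card_le
        · exact Finset.insert_subset h Finset.inter_subset_left
        · rw [Finset.card_insert_of_notMem hat]; omega
      rw [← hs1] at this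
      exact congrArg Subtype.val (e.injective (Subtype.ext this))
    · right
      have : (e ⟨q, hq⟩).1 = s2.1 := by
        rw [← hins]
        apply Finset.eq_of_subset_of_card_le
        · exact Finset.insert_subset h Finset.inter_subset_right
        · rw [Finset.card_insert_of_notMem hat]; omega
      rw [← hs2] at this
      exact congrArg Subtype.val (e.injective (Subtype.ext this))

theorem simplexLike_edge {P : Type} [PartialOrder P] {d : P → ℕ} (hsl : SimplexLike P d)
    {p q₁ q₂ q : P} (hp : d p = 1) (h1 : q₁ ≤ p) (h2 : q₂ ≤ p) (h : q ≤ p)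
    (d1 : d q₁ = 0) (d2 : d q₂ = 0) (d3 : d q = 0) (hne : q₁ ≠ q₂) :
    q = q₁ ∨ q = q₂ := by
  obtain ⟨e⟩ := hsl p
  have c1 := simplexLike_card hsl e ⟨q₁, h1⟩
  have c2 := simplexLike_card hsl e ⟨q₂, h2⟩
  have c3 := simplexLike_card hsl e ⟨q, h⟩
  simp only [d1, d2, d3, zero_add] at c1 c2 c3
  have key : ∀ x y : {q : P // q ≤ p}, (e x).1 = (e y).1 → x.1 = y.1 := fun x y hxy =>
    congrArg Subtype.val (e.injective (Subtype.ext hxy))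
  obtain ⟨a, ha⟩ := Finset.card_eq_one.1 c1
  obtain ⟨b, hb⟩ := Finset.card_eq_one.1 c2
  obtain ⟨c, hc⟩ := Finset.card_eq_one.1 c3
  have hab : a ≠ b := by
    rintro rfl
    exact hne (key _ _ (ha.trans hb.symm))
  have : c = a ∨ c = b := by
    simp only [Fin.ext_iff] at *
    have := a.2; have := b.2; have := c.2
    simp only [ne_eq, Fin.ext_iff] at hab
    omega
  rcases this with rfl | rfl
  · left; exact key ⟨q, h⟩ ⟨q₁, h1⟩ (hc.trans ha.symm)
  · right; exact key ⟨q, h⟩ ⟨q₂, h2⟩ (hc.trans hb.symm)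

theorem simplexLike_other {P : Type} [PartialOrder P] {d : P → ℕ} (hsl : SimplexLike P d)
    {p q r : P} (hrp : r ≤ p) (hpq : p ≤ q) (hd1 : d p = d r + 1) (hd2 : d q = d p + 1) :
    ∃ p', p' ≠ p ∧ r ≤ p' ∧ p' ≤ q ∧ d p' = d p := by
  obtain ⟨e⟩ := hsl q
  have c1 := simplexLike_card hsl e ⟨r, hrp.trans hpq⟩
  have c2 := simplexLike_card hsl e ⟨p, hpq⟩
  have hsub : e ⟨r, hrp.trans hpq⟩ ≤ e ⟨p, hpq⟩ := e.monotone hrp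
  simp only at c1 c2
  generalize hs1 : (e ⟨r, hrp.trans hpq⟩) = s1 at *
  generalize hs2 : (e ⟨p, hpq⟩) = s2 at *
  have hsub' : s1.1 ⊆ s2.1 := hsub
  have hdis : Disjoint s1.1 (s2.1)ᶜ :=
    Finset.disjoint_left.2 fun a ha hb => (Finset.mem_compl.1 hb) (hsub' ha)
  have hcc : (s2.1)ᶜ.card = 1 := by
    rw [Finset.card_compl, Fintype.card_fin]; omega
  let t : SimplexPoset (d q) := ⟨s1.1 ∪ (s2.1)ᶜ, s1.2.mono Finset.subset_union_left⟩
  have htc : t.1.card = d p + 1 := by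
    change (s1.1 ∪ (s2.1)ᶜ).card = _
    rw [Finset.card_union_of_disjoint hdis]; omega
  refine ⟨(e.symm t).1, ?_, ?_, (e.symm t).2, ?_⟩
  · intro h
    have h' : e.symm t = ⟨p, hpq⟩ := Subtype.ext h
    have h2 : t = s2 := by rw [← hs2, ← h', e.apply_symm_apply]
    obtain ⟨a, ha⟩ := Finset.card_pos.1 (show 0 < (s2.1)ᶜ.card by omega)
    have : a ∈ t.1 := Finset.mem_union_right _ ha
    rw [h2] at this
    exact Finset.mem_compl.1 ha this
  · have : (⟨r, hrp.trans hpq⟩ : {x : P // x ≤ q}) ≤ e.symm t := by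
      rw [e.le_symm_apply, hs1]; exact Finset.subset_union_left
    exact this
  · have := simplexLike_card hsl e (e.symm t)
    rw [e.apply_symm_apply] at this
    omega

theorem degFinset_card {P : Type} [PartialOrder P] {d : P → ℕ} (hsl : SimplexLike P d)
    (G : GradedPoset Pᵒᵈ) (hdeg : ∀ p : Pᵒᵈ, G.deg p = (d (OrderDual.ofDual p) : ℤ))
    (p : Pᵒᵈ) (m : ℕ) :
    (degFinset G p m).card = (d (OrderDual.ofDual p) + 1).choose (m + 1) := by
  obtain ⟨e⟩ := hsl (OrderDual.ofDual p)
  have hmem : ∀ q, q ∈ degFinset G p m ↔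
      OrderDual.ofDual q ≤ OrderDual.ofDual p ∧ d (OrderDual.ofDual q) = m := by
    intro q
    simp only [degFinset, Set.Finite.mem_toFinset, degSet, Set.mem_ofPred_eq, hdeg, Nat.cast_inj]
    rfl
  have : (Finset.powersetCard (m + 1)
      (Finset.univ : Finset (Fin (d (OrderDual.ofDual p) + 1)))).card =
      (d (OrderDual.ofDual p) + 1).choose (m + 1) := by
    rw [Finset.card_powersetCard, Finset.card_univ, Fintype.card_fin]
  rw [← this]
  refine Finset.card_bij (fun q hq => (e ⟨OrderDual.ofDual q, ((hmem q).1 hq).1⟩).1) ?_ ?_ ?_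
  · intro q hq
    rw [Finset.mem_powersetCard]
    refine ⟨Finset.subset_univ _, ?_⟩
    rw [simplexLike_card hsl e]
    simp only [((hmem q).1 hq).2]
  · intro q hq q' hq' h
    exact congrArg Subtype.val (e.injective (Subtype.ext h))
  · intro s hs
    have hs' := (Finset.mem_powersetCard.1 hs).2
    let t : SimplexPoset (d (OrderDual.ofDual p)) := ⟨s, Finset.card_pos.1 (by omega)⟩
    have hc := simplexLike_card hsl e (e.symm t)
    rw [e.apply_symm_apply] at hc
    change s.card = _ at hc
    refine ⟨OrderDual.toDual (e.symm t).1, (hmem _).2 ⟨(e.symm t).2, ?_⟩, ?_⟩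
    · change d (e.symm t).1 = m
      omega
    · change (e (e.symm t)).1 = s
      rw [e.apply_symm_apply]

theorem Rnum_choose {P : Type} [PartialOrder P] {d : P → ℕ} (hsl : SimplexLike P d)
    (G : GradedPoset Pᵒᵈ) (hdeg : ∀ p : Pᵒᵈ, G.deg p = (d (OrderDual.ofDual p) : ℤ))
    (m : ℕ) : ∀ p : Pᵒᵈ, Rnum G m p = ((d (OrderDual.ofDual p)).choose m : ℤ) := by
  induction m with
  | zero => intro p; simp [Rnum]
  | succ m ih =>
    intro p
    rw [Rnum, ih p]
    have : ∑ q ∈ degFinset G p m, Rnum G m q = ∑ q ∈ degFinset G p m, (1 : ℤ) := by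
      refine Finset.sum_congr rfl fun q hq => ?_
      have hq' : G.deg q = m := by
        simp only [degFinset, Set.Finite.mem_toFinset, degSet, Set.mem_ofPred_eq] at hq
        exact hq.2
      rw [hdeg] at hq'
      rw [ih q, Nat.cast_inj.1 hq']
      simp
    rw [this, Finset.sum_const, degFinset_card hsl G hdeg, Nat.choose_succ_succ]
    simp

end Prop72Comb

theorem deg_strict {Q : Type} [PartialOrder Q] [Finite Q] (G : GradedPoset Q) {p q : Q}
    (h : p < q) : G.deg q < G.deg p := by
  have : Fintype Q := Fintype.ofFinite Q
  classical
  obtain ⟨r, hr, hrq⟩ := exists_covBy_le_of_lt h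
  have h1 := G.deg_step hr.lt (by
    intro s h1 h2
    by_contra hcon
    push Not at hcon
    exact hr.2 (lt_of_le_of_ne h1 (Ne.symm hcon.1)) (lt_of_le_of_ne h2 hcon.2))
  have h2 := G.deg_antitone hrq
  omega

section Prop72Alg

open Classical in
/-- The component `F_n(q) → F_{n+1}(p)` of the projection. -/
noncomputable def compMap {Q : Type} [PartialOrder Q] (G : GradedPoset Q) {F F' : PosetFunctor Q}
    (n : ℕ) (π : PosetHom (kerPrime G F n) F') (p : Q) (q : degSet G p n) :
    F.obj q.1 →+ F'.obj p :=
  (π.app p).comp (AddMonoidHom.single (fun q : degSet G p n => F.obj q.1) q)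

open Classical in
theorem compMap_apply {Q : Type} [PartialOrder Q] (G : GradedPoset Q) {F F' : PosetFunctor Q}
    (n : ℕ) (π : PosetHom (kerPrime G F n) F') (p : Q) (q : degSet G p n) (x : F.obj q.1) :
    compMap G n π p q x =
      π.app p (Pi.single (M := fun q : degSet G p n => F.obj q.1) q x) := rfl

theorem compMap_sum_mem {Q : Type} [PartialOrder Q] (G : GradedPoset Q) {F F' : PosetFunctor Q}
    (n : ℕ) (π : PosetHom (kerPrime G F n) F') (p : Q) (A : AddSubgroup (F'.obj p))
    (h : ∀ q : degSet G p n, (compMap G n π p q).range ≤ A)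
    (x : (kerPrime G F n).obj p) : π.app p x ∈ A := by
  classical
  have hfin : Finite (degSet G p n) :=
    ((G.finite_up p).subset (show degSet G p n ⊆ {q | p ≤ q} from fun _ hq => hq.1)).to_subtype
  have := Fintype.ofFinite (degSet G p n)
  have hx : x = ∑ q, Pi.single (M := fun q : degSet G p n => F.obj q.1) q (x q) :=
    (Finset.univ_sum_single (M := fun q : degSet G p n => F.obj q.1) x).symm
  rw [hx]
  have h2 := map_sum (π.app p)
    (fun q => Pi.single (M := fun q : degSet G p n => F.obj q.1) q (x q)) Finset.univ
  refine (congrArg (· ∈ A) h2).mpr ?_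
  refine A.sum_mem fun q _ => h q ⟨x q, ?_⟩
  exact compMap_apply G n π p q (x q)

/-- The relation obtained from an element `u` of `F_n(p)` supported on two faces. -/
theorem compMap_two {Q : Type} [PartialOrder Q] (G : GradedPoset Q) {F F' : PosetFunctor Q}
    (n : ℕ) (π : PosetHom (kerPrime G F n) F') (p : Q)
    (hker : (π.app p).ker = ((lambdaNT G F n).app p).range)
    (q₁ q₂ : degSet G p n) (hne : q₁ ≠ q₂) (u : F.obj p)
    (hu : ∀ q : degSet G p n, q ≠ q₁ → q ≠ q₂ → F.map q.2.1 u = 0) :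
    compMap G n π p q₁ (F.map q₁.2.1 u) ∈ (compMap G n π p q₂).range := by
  classical
  have h0 : π.app p ((lambdaNT G F n).app p u) = 0 := by
    have : (lambdaNT G F n).app p u ∈ (π.app p).ker := by rw [hker]; exact ⟨u, rfl⟩
    exact this
  have hs : (lambdaNT G F n).app p u =
      (Pi.single (M := fun q : degSet G p n => F.obj q.1) q₁ (F.map q₁.2.1 u) +
      Pi.single (M := fun q : degSet G p n => F.obj q.1) q₂ (F.map q₂.2.1 u) :
        ∀ q : degSet G p n, F.obj q.1) := by
    funext q
    change F.map q.2.1 u = _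
    by_cases h1 : q = q₁
    · subst h1
      simp [hne]
    · by_cases h2 : q = q₂
      · subst h2
        simp [h1]
      · rw [hu q h1 h2]
        simp [h1, h2]
  rw [hs] at h0
  have h1 := (map_add (π.app p)
    (Pi.single (M := fun q : degSet G p n => F.obj q.1) q₁ (F.map q₁.2.1 u))
    (Pi.single (M := fun q : degSet G p n => F.obj q.1) q₂ (F.map q₂.2.1 u))).symm.trans h0
  refine ⟨-(F.map q₂.2.1 u), ?_⟩
  rw [map_neg, compMap_apply, compMap_apply]
  exact (eq_neg_of_add_eq_zero_left h1).symm

theorem constZ_surj {Q : Type} [PartialOrder Q] (F : PosetFunctor Q) (hF : F = constZ Q)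
    {p q : Q} (h : p ≤ q) : Function.Surjective (F.map h) := by
  subst hF
  intro x
  exact ⟨x, rfl⟩

theorem compMap_surj {Q : Type} [PartialOrder Q] (G : GradedPoset Q) {J : Q → ℕ → Set Q}
    (S : CondensedSequence G J)
    (H1 : ∀ p q₁ q₂ q : Q, p ≤ q₁ → p ≤ q₂ → p ≤ q → G.deg p = 1 → G.deg q₁ = 0 →
      G.deg q₂ = 0 → G.deg q = 0 → q₁ ≠ q₂ → q = q₁ ∨ q = q₂)
    (H2 : ∀ (m : ℕ) (p q₁ q₂ : Q), p ≤ q₁ → p ≤ q₂ → G.deg p = (m : ℤ) + 2 →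
      G.deg q₁ = (m : ℤ) + 1 → G.deg q₂ = (m : ℤ) + 1 → q₁ ≠ q₂ →
      ∃ r, q₁ ≤ r ∧ q₂ ≤ r ∧ G.deg r = m ∧
        ∀ q, p ≤ q → q ≤ r → G.deg q = (m : ℤ) + 1 → q = q₁ ∨ q = q₂)
    (n : ℕ) : ∀ (p : Q) (q : degSet G p n), G.deg p = (n : ℤ) + 1 →
      Function.Surjective (compMap G n (S.pi n) p q) := by
  classical
  -- reduce to comparing the ranges
  have red : ∀ n : ℕ, (∀ (p : Q), G.deg p = (n : ℤ) + 1 → ∀ (q₁ q₂ : degSet G p n),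
      q₁ ≠ q₂ → (compMap G n (S.pi n) p q₁).range ≤ (compMap G n (S.pi n) p q₂).range) →
      ∀ (p : Q) (q : degSet G p n), G.deg p = (n : ℤ) + 1 →
      Function.Surjective (compMap G n (S.pi n) p q) := by
    intro n h p q hp y
    obtain ⟨x, rfl⟩ := S.pi_surj n p y
    refine compMap_sum_mem G n (S.pi n) p (compMap G n (S.pi n) p q).range (fun q' => ?_) x
    by_cases hq : q' = q
    · rw [hq]
    · exact h p hp q' q hq
  induction n with
  | zero =>
    apply red
    intro p hp q₁ q₂ hne
    rintro _ ⟨x, rfl⟩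
    obtain ⟨u, rfl⟩ := constZ_surj (S.F 0) S.F_zero q₁.2.1 x
    refine compMap_two G 0 (S.pi 0) p (S.pi_ker 0 p) q₁ q₂ hne u fun q h1 h2 => ?_
    exfalso
    have a := q.2.2
    have b := q₁.2.2
    have c := q₂.2.2
    simp only [Nat.cast_zero, zero_add] at a b c hp
    rcases H1 p q₁ q₂ q q₁.2.1 q₂.2.1 q.2.1 hp b c a (fun h => hne (Subtype.ext h)) with h | h
    · exact h1 (Subtype.ext h)
    · exact h2 (Subtype.ext h)
  | succ n ih =>
    apply red
    intro p hp q₁ q₂ hne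
    have b := q₁.2.2
    have c := q₂.2.2
    push_cast at hp b c
    obtain ⟨r, hr1, hr2, hrd, hr⟩ := H2 n p q₁ q₂ q₁.2.1 q₂.2.1 (by omega) b c
      (fun h => hne (Subtype.ext h))
    rintro _ ⟨x, rfl⟩
    obtain ⟨z, rfl⟩ := ih q₁ ⟨r, hr1, hrd⟩ b x
    have hpr : p ≤ r := q₁.2.1.trans hr1
    let v : (kerPrime G (S.F n) n).obj p :=
      Pi.single (M := fun q : degSet G p n => (S.F n).obj q.1) ⟨r, hpr, hrd⟩ z
    have hv : ∀ (q : Q) (hq : p ≤ q), (S.F (n+1)).map hq ((S.pi n).app p v) =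
        (S.pi n).app q ((kerPrime G (S.F n) n).map hq v) :=
      fun q hq => (S.pi n).naturality hq v
    have e1 : (S.F (n+1)).map q₁.2.1 ((S.pi n).app p v) =
        compMap G n (S.pi n) q₁ ⟨r, hr1, hrd⟩ z := by
      rw [hv, compMap_apply]
      congr 1
      funext s
      change v ⟨s.1, _⟩ = _
      by_cases hs : s = ⟨r, hr1, hrd⟩
      · subst hs
        simp [v]
      · have : s.1 ≠ r := fun h => hs (Subtype.ext h)
        rw [Pi.single_eq_of_ne hs]
        exact Pi.single_eq_of_ne (fun h => this (congrArg Subtype.val h)) _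
    rw [← e1]
    refine compMap_two G (n+1) (S.pi (n+1)) p (S.pi_ker (n+1) p) q₁ q₂ hne _ fun q h1 h2 => ?_
    have a := q.2.2
    push_cast at a
    rw [hv]
    have : (kerPrime G (S.F n) n).map q.2.1 v = 0 := by
      funext s
      change v ⟨s.1, _⟩ = 0
      have : s.1 ≠ r := by
        intro h
        rcases hr q q.2.1 (h ▸ s.2.1) a with h | h
        · exact h1 (Subtype.ext h)
        · exact h2 (Subtype.ext h)
      exact Pi.single_eq_of_ne (fun h => this (congrArg Subtype.val h)) _
    rw [this, map_zero]

theorem bij_of_surj {A B : Type} [AddCommGroup A] [AddCommGroup B] [Module.Free ℤ A]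
    [Module.Finite ℤ A] [Module.Free ℤ B] [Module.Finite ℤ B]
    (h : Module.finrank ℤ A = Module.finrank ℤ B) (g : A →+ B) (hg : Function.Surjective g) :
    Function.Injective g := by
  let e := LinearEquiv.ofFinrankEq (R := ℤ) B A h.symm
  let k : A →ₗ[ℤ] A := e.toLinearMap.comp g.toIntLinearMap
  have hk : Function.Surjective k := e.surjective.comp hg
  have := OrzechProperty.injective_of_surjective_endomorphism k hk
  intro x y hxy
  apply this
  change e (g x) = e (g y)
  rw [hxy]

theorem finFree_torsion {A : Type} [AddCommGroup A] [Module.Free ℤ A] (m : ℤ) (hm : m ≠ 0)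
    (x : A) (h : m • x = 0) : x = 0 :=
  (smul_eq_zero.1 h).resolve_left hm

theorem pure_of_divisible {A B : Type} [AddCommGroup A] [AddCommGroup B]
    (hB : Module.Finite ℤ B) (w : A →+ B)
    (h : ∀ (m : ℤ) (y : B), m ≠ 0 → m • y ∈ w.range → y ∈ w.range) : IsPureHom w := by
  unfold IsPureHom
  have hf : Module.Finite ℤ (B ⧸ w.range) :=
    Module.Finite.of_surjective (QuotientAddGroup.mk' w.range).toIntLinearMap
      (QuotientAddGroup.mk'_surjective _)
  have ht : Module.IsTorsionFree ℤ (B ⧸ w.range) := by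
    refine Module.IsTorsionFree.of_smul_eq_zero fun m y hy => ?_
    by_cases hm : m = 0
    · exact Or.inl hm
    · right
      obtain ⟨y, rfl⟩ := QuotientAddGroup.mk'_surjective _ y
      rw [← map_zsmul] at hy
      have := (QuotientAddGroup.eq_zero_iff _).1 hy
      exact (QuotientAddGroup.eq_zero_iff _).2 (h m y hm this)
  exact Module.free_of_finite_type_torsion_free'

theorem gcf_of_triangular {Q : Type} [PartialOrder Q] [Finite Q] (G : GradedPoset Q)
    {J : Q → ℕ → Set Q}
    (S : CondensedSequence G J)
    (H1 : ∀ p q₁ q₂ q : Q, p ≤ q₁ → p ≤ q₂ → p ≤ q → G.deg p = 1 → G.deg q₁ = 0 →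
      G.deg q₂ = 0 → G.deg q = 0 → q₁ ≠ q₂ → q = q₁ ∨ q = q₂)
    (H2 : ∀ (m : ℕ) (p q₁ q₂ : Q), p ≤ q₁ → p ≤ q₂ → G.deg p = (m : ℤ) + 2 →
      G.deg q₁ = (m : ℤ) + 1 → G.deg q₂ = (m : ℤ) + 1 → q₁ ≠ q₂ →
      ∃ r, q₁ ≤ r ∧ q₂ ≤ r ∧ G.deg r = m ∧
        ∀ q, p ≤ q → q ≤ r → G.deg q = (m : ℤ) + 1 → q = q₁ ∨ q = q₂)
    (HR : ∀ (n : ℕ) (p : Q), G.deg p = n → Rnum G n p = 1)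
    (K : ℕ → Set Q) (f : Q → ℝ) (hK : ∀ n, K n ⊆ obSet G n)
    (HK : ∀ (n : ℕ) (q : Q), G.deg q = n → q ∉ K n → ∃ p ∈ K (n + 1), p ≤ q ∧
      ∀ q', p ≤ q' → G.deg q' = n → q' ≠ q → f q' < f q) :
    IsGCF G S.F S.pi K := by
  classical
  have hfree : ∀ n p, Module.Free ℤ ((S.F n).obj p) := fun n p => (S.free n p).1
  have hfinite : ∀ n p, Module.Finite ℤ ((S.F n).obj p) := fun n p => (S.free n p).2
  have surj := compMap_surj G S H1 H2
  have inj : ∀ (n : ℕ) (p : Q) (q : degSet G p n), G.deg p = (n : ℤ) + 1 →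
      Function.Injective (compMap G n (S.pi n) p q) := by
    intro n p q hp
    apply bij_of_surj _ _ (surj n p q hp)
    have a := S.rank_eq n q (le_of_eq q.2.2.symm)
    have b := S.rank_eq (n + 1) p (by push_cast; omega)
    rw [HR n q q.2.2] at a
    rw [HR (n + 1) p (by push_cast; omega)] at b
    exact_mod_cast a.trans b.symm
  have wf : WellFounded (fun a b : Q => f a < f b) := by
    have : IsTrans Q (fun a b : Q => f a < f b) := ⟨fun _ _ _ => lt_trans⟩
    have : Std.Irrefl (fun a b : Q => f a < f b) := ⟨fun _ => lt_irrefl _⟩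
    exact Finite.wellFounded_of_trans_of_irrefl _
  refine ⟨hK, ?_, ?_⟩
  · intro n
    -- kernel is trivial
    have key : ∀ s ∈ PosetFunctor.sections (S.F n), (∀ p ∈ K n, s p = 0) → s = 0 := by
      intro s hs hz
      have hs' : ∀ (p q : Q) (h : p ≤ q), (S.F n).map h (s p) = s q := hs
      have hn : ∀ q, G.deg q = n → s q = 0 := by
        intro q
        induction q using wf.induction with
        | _ q ih =>
        intro hq
        by_cases hqK : q ∈ K n
        · exact hz q hqK
        · obtain ⟨p, hpK, hpq, hp⟩ := HK n q hq hqK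
          have hpd : G.deg p = (n : ℤ) + 1 := by
            have := hK _ hpK
            simpa [obSet] using this
          have h0 : (S.pi n).app p ((lambdaNT G (S.F n) n).app p (s p)) = 0 := by
            have : (lambdaNT G (S.F n) n).app p (s p) ∈ ((S.pi n).app p).ker := by
              rw [S.pi_ker]; exact ⟨_, rfl⟩
            exact this
          have hl : (lambdaNT G (S.F n) n).app p (s p) =
              Pi.single (M := fun q : degSet G p n => (S.F n).obj q.1) ⟨q, hpq, hq⟩ (s q) := by
            funext q'
            change (S.F n).map q'.2.1 (s p) = _
            rw [hs']
            by_cases h : q' = ⟨q, hpq, hq⟩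
            · subst h; simp
            · rw [Pi.single_eq_of_ne h]
              have hne : q'.1 ≠ q := fun h' => h (Subtype.ext h')
              exact ih _ (hp _ q'.2.1 q'.2.2 hne) q'.2.2
          rw [hl] at h0
          apply inj n p ⟨q, hpq, hq⟩ hpd
          rw [map_zero]
          exact h0
      have hall : ∀ (k : ℕ) (p : Q), G.deg p = k → s p = 0 := by
        intro k
        induction k using Nat.strong_induction_on with
        | _ k ih =>
        intro p hp
        rcases lt_trichotomy k n with h | h | h
        · exact (S.condensed n).1 p (by rw [hp]; exact_mod_cast h) _
        · exact hn p (by rw [hp, h])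
        · refine (S.condensed n).2 p (by rw [hp]; exact_mod_cast h) _ fun q hpq => ?_
          rw [hs']
          have hlt : G.deg q < G.deg p := deg_strict G hpq
          have h0 := G.deg_nonneg q
          exact ih (G.deg q).toNat (by omega) q (by omega)
      funext p
      exact hall (G.deg p).toNat p (Int.toNat_of_nonneg (G.deg_nonneg p)).symm
    intro s t hst
    apply Subtype.ext
    have := key (s.1 - t.1) ((PosetFunctor.sections (S.F n)).sub_mem s.2 t.2) (by
      intro p hp
      have := congrFun hst ⟨p, hp⟩
      exact sub_eq_zero.2 this)
    exact sub_eq_zero.1 this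
  · intro n
    have hfq : Finite (K (n + 1)) := inferInstance
    apply pure_of_divisible
    · exact Module.Finite.pi
    · rintro m y hm ⟨x, hx⟩
      set X : ∀ p, (S.F n).obj p := extendZero (obSet G n \ K n) x with hX
      have hXz : ∀ q, q ∉ obSet G n \ K n → X q = 0 := by
        intro q hq
        simp only [hX]
        exact dif_neg hq
      have hXw : ∀ p : K (n + 1), (S.pi n).app p.1 (fun q : degSet G p.1 n => X q.1) =
          m • y p := by
        intro p
        have := congrFun hx p
        exact this
      have hdiv : ∀ q, G.deg q = n → ∃ z, X q = m • z := by
        intro q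
        induction q using wf.induction with
        | _ q ih =>
        intro hq
        by_cases hqK : q ∈ K n
        · exact ⟨0, by rw [hXz q (fun h => h.2 hqK), smul_zero]⟩
        · obtain ⟨p, hpK, hpq, hp⟩ := HK n q hq hqK
          have hpd : G.deg p = (n : ℤ) + 1 := by
            have := hK _ hpK
            simpa [obSet] using this
          have hz : ∀ q' : degSet G p n, ∃ z, q'.1 ≠ q → X q'.1 = m • z := by
            intro q'
            by_cases h : q'.1 = q
            · exact ⟨0, fun h' => absurd h h'⟩
            · obtain ⟨z, hz⟩ := ih _ (hp _ q'.2.1 q'.2.2 h) q'.2.2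
              exact ⟨z, fun _ => hz⟩
          choose z hz using hz
          let q0 : degSet G p n := ⟨q, hpq, hq⟩
          let Z : (kerPrime G (S.F n) n).obj p := fun q' => if q'.1 = q then 0 else z q'
          let E : (kerPrime G (S.F n) n).obj p :=
            Pi.single (M := fun q : degSet G p n => (S.F n).obj q.1) q0 (X q)
          have hdec : (fun q : degSet G p n => X q.1 : (kerPrime G (S.F n) n).obj p) =
              E + m • Z := by
            funext q'
            change X q'.1 = E q' + m • Z q'
            by_cases h : q' = q0
            · subst h
              simp [E, Z, q0]
            · have hne : q'.1 ≠ q := fun h' => h (Subtype.ext h')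
              have : E q' = 0 := Pi.single_eq_of_ne h _
              rw [this, zero_add, hz q' hne]
              simp [Z, hne]
          have h1 := hXw ⟨p, hpK⟩
          simp only at h1
          rw [hdec, map_add, map_zsmul] at h1
          obtain ⟨c, hc⟩ := surj n p q0 hpd (y ⟨p, hpK⟩ - (S.pi n).app p Z)
          refine ⟨c, ?_⟩
          apply inj n p q0 hpd
          rw [map_zsmul, hc, smul_sub, ← h1]
          change (S.pi n).app p E = _
          abel
      have hz : ∀ q : ↥(obSet G n \ K n), ∃ z, X q.1 = m • z := fun q => hdiv q q.2.1
      choose z hz using hz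
      refine ⟨z, ?_⟩
      have hxz : x = m • z := by
        funext q
        have : X q.1 = x q := by
          simp [hX, extendZero, q.2.1, q.2.2]
        rw [← this, hz]; rfl
      rw [hxz, map_zsmul] at hx
      funext p
      have := congrFun hx p
      have h2 : m • (wMap G S.F S.pi K n z p - y p) = 0 := by
        rw [smul_sub, sub_eq_zero]; exact this
      exact sub_eq_zero.1 (finFree_torsion m hm _ h2)

end Prop72Alg

section Prop72Morse

theorem ncard_le_one_eq {P : Type} [Finite P] {A : Set P} (h : A.ncard ≤ 1) {a b : P}
    (ha : a ∈ A) (hb : b ∈ A) : a = b :=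
  (Set.ncard_le_one (Set.toFinite A)).1 h a ha b hb

theorem ncard_eq_one_of_mem {P : Type} [Finite P] {A : Set P} (h : A.ncard ≤ 1) {a : P}
    (ha : a ∈ A) : A.ncard = 1 := by
  have := (Set.ncard_pos (Set.toFinite A)).2 ⟨a, ha⟩
  omega

/-- Forman's lemma: the two exceptional sets are not both nonempty. -/
theorem forman {P : Type} [PartialOrder P] [Finite P] {d : P → ℕ} (hsl : SimplexLike P d)
    {f : P → ℝ} (hf : IsMorse d f) {p q r : P} (hq : q ∈ upSetMorse d f p)
    (hr : r ∈ downSetMorse d f p) : False := by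
  obtain ⟨hpq, hd2, hfq⟩ := hq
  obtain ⟨hrp, hd1, hfr⟩ := hr
  obtain ⟨p', hne, h1, h2, h3⟩ := simplexLike_other hsl hrp.le hpq.le hd1 hd2
  have hr' : r < p' := lt_of_le_of_ne h1 (by rintro rfl; omega)
  have hq' : p' < q := lt_of_le_of_ne h2 (by rintro rfl; omega)
  have a : f r < f p' := by
    by_contra hcon
    exact hne (ncard_le_one_eq (hf r).1 (a := p') (b := p)
      ⟨hr', by omega, not_lt.1 hcon⟩ ⟨hrp, hd1, hfr⟩)
  have b : f p' < f q := by
    by_contra hcon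
    exact hne (ncard_le_one_eq (hf q).2 (a := p') (b := p)
      ⟨hq', by omega, not_lt.1 hcon⟩ ⟨hpq, hd2, hfq⟩)
  linarith

/-- A simplex outside `K_n` is paired with a simplex above it. -/
theorem morse_up {P : Type} [PartialOrder P] [Finite P] {d : P → ℕ}
    {f : P → ℝ} (hf : IsMorse d f) {q : P}
    (hq : ¬ (IsCritical d f q ∨ (downSetMorse d f q).ncard = 1)) :
    ∃ p, p ∈ upSetMorse d f q := by
  by_contra hcon
  push Not at hcon hq
  have hu : upSetMorse d f q = ∅ := Set.eq_empty_of_forall_notMem hcon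
  have hd : (downSetMorse d f q).ncard = 0 := by
    have := (hf q).2
    have := hq.2
    omega
  exact hq.1 ⟨hu, (Set.ncard_eq_zero (Set.toFinite _)).1 hd⟩

theorem morse_card {P : Type} [PartialOrder P] [Finite P] {d : P → ℕ} (hsl : SimplexLike P d)
    {f : P → ℝ} (hf : IsMorse d f) (n : ℕ) :
    {q : P | d q = n ∧ ¬ (IsCritical d f q ∨ (downSetMorse d f q).ncard = 1)}.ncard =
    {p : P | d p = n + 1 ∧ (downSetMorse d f p).ncard = 1}.ncard := by
  have hup : ∀ q ∈ {q : P | d q = n ∧ ¬ (IsCritical d f q ∨ (downSetMorse d f q).ncard = 1)},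
      ∃ p, p ∈ upSetMorse d f q := fun q hq => morse_up hf hq.2
  choose! V hV using hup
  have hd : ∀ {p q : P}, p ∈ upSetMorse d f q → q ∈ downSetMorse d f p :=
    fun h => ⟨h.1, h.2.1, h.2.2⟩
  refine Set.ncard_congr (fun q _ => V q) ?_ ?_ ?_
  · intro q hq
    have h := hV q hq
    exact ⟨by rw [h.2.1, hq.1], ncard_eq_one_of_mem (hf _).2 (hd h)⟩
  · intro q q' hq hq' h
    have a := hd (hV q hq)
    have b := hd (hV q' hq')
    rw [← h] at b
    exact ncard_le_one_eq (hf _).2 a b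
  · rintro p ⟨hp, hc⟩
    obtain ⟨q, hqe⟩ := Set.ncard_eq_one.1 hc
    have hq : q ∈ downSetMorse d f p := by rw [hqe]; rfl
    have hpu : p ∈ upSetMorse d f q := ⟨hq.1, hq.2.1, hq.2.2⟩
    have hqm : q ∈ {q : P | d q = n ∧ ¬ (IsCritical d f q ∨ (downSetMorse d f q).ncard = 1)} := by
      refine ⟨?_, ?_⟩
      · have := hq.2.1; omega
      · rintro (h | h)
        · have := h.1 ▸ hpu
          exact this
        · obtain ⟨r, hr⟩ := Set.ncard_eq_one.1 h
          exact forman hsl hf hpu (r := r) (by rw [hr]; rfl)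
    exact ⟨q, hqm, ncard_le_one_eq (hf q).1 (hV q hqm) hpu⟩

theorem sum_toFinset_eq_ncard {P : Type} (g : P → ℤ) (T : Finset P) (A : Set P)
    (h : ∀ p, p ∈ T ↔ p ∈ A) (hg : ∀ p ∈ T, g p = 1) : ∑ p ∈ T, g p = (A.ncard : ℤ) := by
  have : A = (T : Set P) := by ext p; exact (h p).symm
  rw [Finset.sum_congr rfl hg, this, Set.ncard_coe_finset]
  simp

end Prop72Morse

/-- **Proposition 7.2.** Let `𝒫` be a finite simplicial complex (a simplex-like poset in
which any two simplices with a lower bound have an infimum) and `f : 𝒫 → ℝ` a discrete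
Morse function. Then the family `𝒦` with `K_n = C_n ∪ D_n` is a global covering family
for `𝒫^op`, and for each `n ≥ 0` its Betti number `b_n^𝒦` equals the number of critical
simplices of dimension `n`. -/
theorem prop_7_2 {P : Type} [PartialOrder P] [Fintype P] (d : P → ℕ)
    (hsl : SimplexLike P d)
    (hinf : ∀ p q : P, (∃ r, r ≤ p ∧ r ≤ q) →
      ∃ m, m ≤ p ∧ m ≤ q ∧ ∀ r, r ≤ p → r ≤ q → r ≤ m)
    (f : P → ℝ) (hf : IsMorse d f)
    (G : GradedPoset Pᵒᵈ)
    (hdeg : ∀ p : Pᵒᵈ, G.deg p = (d (OrderDual.ofDual p) : ℤ))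
    (J : Pᵒᵈ → ℕ → Set Pᵒᵈ) (hJ : IsAdequate G J) (S : CondensedSequence G J)
    (hfin : ∀ i : ℤ, {p : Pᵒᵈ | G.deg p = i}.Finite) :
    IsGCF G S.F S.pi (morseK d f) ∧
    ∀ n : ℕ, bettiK G hfin (morseK d f) n =
      ({p : P | d p = n ∧ IsCritical d f p}.ncard : ℤ) := by
  have HR : ∀ (n : ℕ) (p : Pᵒᵈ), G.deg p = n → Rnum G n p = 1 := by
    intro n p hp
    rw [hdeg, Nat.cast_inj] at hp
    rw [Rnum_choose hsl G hdeg, hp]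
    simp
  constructor
  · refine gcf_of_triangular G S ?_ ?_ HR (morseK d f) (fun p => f (OrderDual.ofDual p)) ?_ ?_
    · intro p q₁ q₂ q h1 h2 h3 hp d1 d2 d3 hne
      rw [hdeg] at hp d1 d2 d3
      exact simplexLike_edge (P := P) hsl (p := OrderDual.ofDual p) (q₁ := OrderDual.ofDual q₁)
        (q₂ := OrderDual.ofDual q₂) (q := OrderDual.ofDual q) (by omega) h1 h2 h3
        (by omega) (by omega) (by omega) hne
    · intro m p q₁ q₂ h1 h2 hp d1 d2 hne
      rw [hdeg] at hp d1 d2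
      obtain ⟨r, hr1, hr2, hrd, hr⟩ := simplexLike_diamond (P := P) hsl (m := m)
        (p := OrderDual.ofDual p) (q₁ := OrderDual.ofDual q₁)
        (q₂ := OrderDual.ofDual q₂) (by omega) h1 h2 (by omega) (by omega) hne
      refine ⟨OrderDual.toDual r, hr1, hr2, ?_, ?_⟩
      · rw [hdeg, OrderDual.ofDual_toDual, hrd]
      · intro q hq hqr hqd
        rw [hdeg] at hqd
        exact hr (OrderDual.ofDual q) hq hqr (by omega)
    · rintro n p ⟨hp, _⟩
      change G.deg p = n
      rw [hdeg, hp]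
    · intro n q hq hqK
      rw [hdeg, Nat.cast_inj] at hq
      obtain ⟨p, hpq, hpd, hpf⟩ := morse_up hf (q := OrderDual.ofDual q) fun h => hqK ⟨hq, h⟩
      have hmem : OrderDual.ofDual q ∈ downSetMorse d f p := ⟨hpq, hpd, hpf⟩
      refine ⟨OrderDual.toDual p, ⟨?_, Or.inr ?_⟩, hpq.le, ?_⟩
      · rw [OrderDual.ofDual_toDual]; omega
      · exact ncard_eq_one_of_mem (hf p).2 hmem
      · intro q' hq' hqd' hne
        rw [hdeg, Nat.cast_inj] at hqd'
        have hle : OrderDual.ofDual q' ≤ p := hq'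
        have hlt : OrderDual.ofDual q' < p := lt_of_le_of_ne hle (by
          intro h; rw [h] at hqd'; omega)
        refine lt_of_lt_of_le ?_ hpf
        by_contra hcon
        exact hne (ncard_le_one_eq (hf p).2 (a := OrderDual.ofDual q')
          (b := OrderDual.ofDual q) ⟨hlt, by omega, not_lt.1 hcon⟩ hmem)
  · have sK : ∀ n, ∑ p ∈ KFinset G hfin (morseK d f) n, Rnum G n p =
        ({p : P | d p = n ∧ (IsCritical d f p ∨ (downSetMorse d f p).ncard = 1)}.ncard : ℤ) := by
      intro n
      have hm : ∀ p : Pᵒᵈ, p ∈ KFinset G hfin (morseK d f) n ↔ G.deg p = n ∧ p ∈ morseK d f n := by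
        intro p
        rw [KFinset, Set.Finite.mem_toFinset]
        rfl
      refine sum_toFinset_eq_ncard (P := Pᵒᵈ) _ _ _ (fun p => ?_)
        (fun p hp => HR n p ((hm p).1 hp).1)
      rw [hm]
      constructor
      · rintro ⟨_, h⟩
        exact h
      · intro h
        refine ⟨?_, h⟩
        rw [hdeg, Nat.cast_inj]
        exact h.1
    have sO : ∀ n, ∑ p ∈ obFinset G hfin n, Rnum G n p =
        ({p : P | d p = n}.ncard : ℤ) := by
      intro n
      have hm : ∀ p : Pᵒᵈ, p ∈ obFinset G hfin n ↔ G.deg p = n := by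
        intro p
        rw [obFinset, Set.Finite.mem_toFinset]
        rfl
      refine sum_toFinset_eq_ncard (P := Pᵒᵈ) _ _ _ (fun p => ?_)
        (fun p hp => HR n p ((hm p).1 hp))
      rw [hm, hdeg, Nat.cast_inj]
      rfl
    have split : ∀ n, {p : P | d p = n ∧
        (IsCritical d f p ∨ (downSetMorse d f p).ncard = 1)}.ncard =
        {p : P | d p = n ∧ IsCritical d f p}.ncard +
        {p : P | d p = n ∧ (downSetMorse d f p).ncard = 1}.ncard := by
      intro n
      rw [← Set.ncard_union_eq]
      · congr 1
        ext p
        constructor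
        · rintro ⟨h, h1 | h1⟩
          · exact Or.inl ⟨h, h1⟩
          · exact Or.inr ⟨h, h1⟩
        · rintro (⟨h, h1⟩ | ⟨h, h1⟩)
          · exact ⟨h, Or.inl h1⟩
          · exact ⟨h, Or.inr h1⟩
      · rw [Set.disjoint_left]
        rintro p ⟨_, h⟩ ⟨_, h'⟩
        rw [h.2, Set.ncard_empty] at h'
        omega
    have splitO : ∀ n, {p : P | d p = n}.ncard =
        {p : P | d p = n ∧ (IsCritical d f p ∨ (downSetMorse d f p).ncard = 1)}.ncard +
        {p : P | d p = n ∧ ¬ (IsCritical d f p ∨ (downSetMorse d f p).ncard = 1)}.ncard := by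
      intro n
      rw [← Set.ncard_union_eq]
      · congr 1
        ext p
        constructor
        · intro h
          by_cases h1 : IsCritical d f p ∨ (downSetMorse d f p).ncard = 1
          · exact Or.inl ⟨h, h1⟩
          · exact Or.inr ⟨h, h1⟩
        · rintro (h | h)
          · exact h.1
          · exact h.1
      · rw [Set.disjoint_left]
        rintro p ⟨_, h⟩ ⟨_, h'⟩
        exact h' h
    intro n
    cases n with
    | zero =>
      rw [bettiK, sK, split]
      have : {p : P | d p = 0 ∧ (downSetMorse d f p).ncard = 1} = ∅ := by
        apply Set.eq_empty_of_forall_notMem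
        rintro p ⟨hp, h⟩
        obtain ⟨q, hq⟩ := Set.ncard_eq_one.1 h
        have hq' : q ∈ downSetMorse d f p := by rw [hq]; rfl
        have := hq'.2.1
        omega
      rw [this, Set.ncard_empty, add_zero]
    | succ n =>
      rw [bettiK, sK, sK, sO, splitO, morse_card hsl hf, split (n + 1)]
      push_cast
      ring
end
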